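/- arXiv:2211.02522 — 3 statements merged into one kernel-verified Lean document; each statement's English description precedes it below -/
import Mathlib

section
/- Let C be a convex subset of X and let b ∈ X \ C be such that ⟨w, w⟩ > 0 for every nonzero w ∈ C − b. If the function x ↦ ⟨x, x⟩ attains a minimum value on C − b, then there exists α ∈ C − b such that ⟨α, b⟩ < ⟨α, x⟩ for every x ∈ C. -/
/-- Proposition 3.4: strict separation of `b` from the convex set `C` via the minimizer
of the "norm" over the translate `C - b`. -/
theorem stmt_1 {X : Type*} [AddCommGroup X] [Module ℝ X]
    (B : X →ₗ[ℝ] X →ₗ[ℝ] ℝ) (hBsymm : ∀ u v : X, B u v = B v u)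
    (C : Set X) (hC : Convex ℝ C) (b : X) (hb : b ∉ C)
    (hpd : ∀ w ∈ (fun x => x - b) '' C, w ≠ 0 → 0 < B w w)
    (hmin : ∃ m ∈ (fun x => x - b) '' C, ∀ w ∈ (fun x => x - b) '' C, B m m ≤ B w w) :
    ∃ α ∈ (fun x => x - b) '' C, ∀ x ∈ C, B α b < B α x := by
  obtain ⟨_, ⟨c, hc, rfl⟩, hm⟩ := hmin
  refine ⟨c - b, ⟨c, hc, rfl⟩, fun x hx => ?_⟩
  have hpos : 0 < B (c - b) (c - b) :=
    hpd _ ⟨c, hc, rfl⟩ (sub_ne_zero.2 fun h => hb (h ▸ hc))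
  suffices h : 0 ≤ B (c - b) (x - c) by
    have hsplit : B (c - b) x - B (c - b) b = B (c - b) (x - c) + B (c - b) (c - b) := by
      simp only [← map_sub, ← map_add, sub_add_sub_cancel]
    linarith
  have hvar : ∀ t : ℝ, 0 < t → t ≤ 1 →
      0 ≤ 2 * B (c - b) (x - c) + t * B (x - c) (x - c) := by
    intro t ht ht1
    have hle := hm (c + t • (x - c) - b)
      ⟨_, hC.add_smul_sub_mem hc hx ⟨ht.le, ht1⟩, rfl⟩
    rw [add_sub_right_comm] at hle
    have hexpand : B (c - b + t • (x - c)) (c - b + t • (x - c)) =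
        B (c - b) (c - b) + t * (2 * B (c - b) (x - c) + t * B (x - c) (x - c)) := by
      rw [B.map_add, LinearMap.add_apply, map_add, map_add, B.map_smul, LinearMap.smul_apply,
        LinearMap.smul_apply, map_smul, map_smul, hBsymm (x - c) (c - b)]
      simp only [smul_eq_mul]
      ring
    refine nonneg_of_mul_nonneg_right ?_ ht
    simp only at hle
    linarith
  by_contra! hneg
  set q := B (c - b) (x - c)
  set r := B (x - c) (x - c)
  have hden : 0 < -q + |r| := by linarith [abs_nonneg r]
  have h := hvar (-q / (-q + |r|)) (div_pos (by linarith) hden)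
    ((div_le_one hden).2 (by linarith [abs_nonneg r]))
  have hbound : -q / (-q + |r|) * r ≤ -q := by
    rw [div_mul_eq_mul_div, div_le_iff₀ hden]
    exact mul_le_mul_of_nonneg_left (by linarith [le_abs_self r]) (by linarith)
  linarith
end

section
/- (1st generalized form of Farkas' Lemma.) Assume that ⟨z, z⟩_Y > 0 for every nonzero z in the set {A x − b : x ∈ S} and that the function z ↦ ⟨z, z⟩_Y attains a minimum on {A x − b : x ∈ S}. Then exactly one of the following two problems has a solution: (I) there exists x ∈ S with A x = b; (II) there exists y ∈ Y with −A^T y ∈ S* and ⟨y, −b⟩_Y < 0. -/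
/-- If `2 t p + t² q` is nonnegative for all `t ∈ (0, 1]`, its linear coefficient is nonnegative. -/
theorem nonneg_of_quadratic_nonneg {p q : ℝ}
    (h : ∀ t : ℝ, 0 < t → t ≤ 1 → 0 ≤ 2 * t * p + t ^ 2 * q) : 0 ≤ p := by
  by_contra! hp
  have hd : 0 < |q| - p + 1 := by linarith [abs_nonneg q]
  set t : ℝ := -p / (|q| - p + 1) with ht
  have htd : t * (|q| - p + 1) = -p := div_mul_cancel₀ _ hd.ne'
  have htpos : 0 < t := div_pos (by linarith) hd
  have ht1 : t ≤ 1 := (div_le_one hd).2 (by linarith [abs_nonneg q])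
  have htq : t * q ≤ -p :=
    htd ▸ mul_le_mul_of_nonneg_left (by linarith [le_abs_self q]) htpos.le
  nlinarith [h t htpos ht1, mul_le_mul_of_nonneg_left htq htpos.le, mul_pos_of_neg_of_neg hp hp]

/-- First-order optimality: a minimizer of `z ↦ B z z` over a set has nonnegative pairing with every
direction that stays in the set for step sizes in `(0, 1]`. -/
theorem bilin_nonneg_of_isMin {Y : Type*} [AddCommGroup Y] [Module ℝ Y]
    (B : Y →ₗ[ℝ] Y →ₗ[ℝ] ℝ) (hB : ∀ u v : Y, B u v = B v u) {C : Set Y} {z d : Y}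
    (hz : ∀ w ∈ C, B z z ≤ B w w) (hd : ∀ t : ℝ, 0 < t → t ≤ 1 → z + t • d ∈ C) :
    0 ≤ B z d := by
  refine nonneg_of_quadratic_nonneg (q := B d d) fun t ht ht1 => ?_
  have h := hz _ (hd t ht ht1)
  simp only [map_add, map_smul, LinearMap.add_apply, LinearMap.smul_apply, smul_eq_mul,
    hB d z] at h
  linarith

/-- 1st generalized form of Farkas' Lemma (Theorem 3.5). -/
theorem stmt_2 {X Y : Type*} [AddCommGroup X] [Module ℝ X] [AddCommGroup Y] [Module ℝ Y]
    (BX : X →ₗ[ℝ] X →ₗ[ℝ] ℝ) (hBXsymm : ∀ u v : X, BX u v = BX v u)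
    (BY : Y →ₗ[ℝ] Y →ₗ[ℝ] ℝ) (hBYsymm : ∀ u v : Y, BY u v = BY v u)
    (S : Set X) (hS0 : (0 : X) ∈ S)
    (hSadd : ∀ x ∈ S, ∀ x' ∈ S, x + x' ∈ S)
    (hSsmul : ∀ r : ℝ, 0 ≤ r → ∀ x ∈ S, r • x ∈ S)
    (A : X →ₗ[ℝ] Y) (At : Y →ₗ[ℝ] X)
    (hadj : ∀ (x : X) (y : Y), BY y (A x) = BX (At y) x)
    (b : Y)
    (hpd : ∀ z ∈ (fun x => A x - b) '' S, z ≠ 0 → 0 < BY z z)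
    (hmin : ∃ z₀ ∈ (fun x => A x - b) '' S, ∀ z ∈ (fun x => A x - b) '' S, BY z₀ z₀ ≤ BY z z) :
    Xor' (∃ x ∈ S, A x = b)
      (∃ y : Y, (∀ x ∈ S, 0 ≤ BX (-(At y)) x) ∧ BY y (-b) < 0) := by
  have hcert : (∃ x ∈ S, A x = b) →
      ¬ ∃ y : Y, (∀ x ∈ S, 0 ≤ BX (-(At y)) x) ∧ BY y (-b) < 0 := by
    rintro ⟨x, hx, rfl⟩ ⟨y, hy, hyb⟩
    have h := hy x hx
    simp only [map_neg, LinearMap.neg_apply, hadj] at h hyb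
    linarith
  by_cases hI : ∃ x ∈ S, A x = b
  · exact Or.inl ⟨hI, hcert hI⟩
  refine Or.inr ⟨?_, hI⟩
  obtain ⟨_, ⟨x₀, hx₀, rfl⟩, hz⟩ := hmin
  have hpos := hpd _ ⟨x₀, hx₀, rfl⟩ fun h => hI ⟨x₀, hx₀, sub_eq_zero.1 h⟩
  simp only at hz hpos
  have hdual : ∀ x ∈ S, 0 ≤ BY (A x₀ - b) (A x) := fun x hx =>
    bilin_nonneg_of_isMin BY hBYsymm hz fun t ht _ =>
      ⟨x₀ + t • x, hSadd _ hx₀ _ (hSsmul t ht.le _ hx), by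
        simp only [map_add, map_smul]; abel⟩
  have hshrink : 0 ≤ BY (A x₀ - b) (-(A x₀)) :=
    bilin_nonneg_of_isMin BY hBYsymm hz fun t _ ht1 =>
      ⟨(1 - t) • x₀, hSsmul _ (sub_nonneg.2 ht1) _ hx₀, by
        simp only [map_smul]; module⟩
  refine ⟨-(A x₀ - b), fun x hx => ?_, ?_⟩
  · rw [map_neg At, neg_neg, ← hadj]
    exact hdual x hx
  · rw [map_sub (BY (A x₀ - b))] at hpos
    rw [map_neg] at hshrink
    rw [map_neg BY, LinearMap.neg_apply, map_neg, neg_neg]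
    linarith [hdual x₀ hx₀]
end

section
/- (2nd generalized form of Farkas' Lemma.) Assume that ⟨w, w⟩_X > 0 for every nonzero w in the set {A^T y − c : y ∈ T} and that the function w ↦ ⟨w, w⟩_X attains a minimum on {A^T y − c : y ∈ T}. Then exactly one of the following two problems has a solution: (I') there exists y ∈ T with A^T y = c; (II') there exists x ∈ X with A x ∈ T* and ⟨x, c⟩_X < 0. -/
/-- First-order optimality: if a symmetric bilinear form's quadratic form does not decrease along
the segment from `w` to `w + d`, then its derivative at `w` in direction `d` is nonnegative. -/
theorem LinearMap.nonneg_of_forall_le_add_smul {X : Type*} [AddCommGroup X] [Module ℝ X]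
    (B : X →ₗ[ℝ] X →ₗ[ℝ] ℝ) (hB : ∀ u v : X, B u v = B v u) {w d : X}
    (h : ∀ t : ℝ, 0 ≤ t → t ≤ 1 → B w w ≤ B (w + t • d) (w + t • d)) : 0 ≤ B w d := by
  by_contra! hneg
  have hq := abs_nonneg (B d d)
  have hden : 0 < |B d d| - B w d := by linarith
  obtain ⟨t, ht⟩ : ∃ t, t = -B w d / (|B d d| - B w d) := ⟨_, rfl⟩
  have ht0 : 0 < t := ht ▸ div_pos (by linarith) hden
  have ht1 : t ≤ 1 := by rw [ht, div_le_one hden]; linarith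
  have hmul : t * (|B d d| - B w d) = -B w d := by rw [ht]; field_simp
  have hle := h t ht0.le ht1
  simp only [map_add, map_smul, LinearMap.add_apply, LinearMap.smul_apply, smul_eq_mul,
    hB d w] at hle
  have hfac : 0 ≤ t * (2 * B w d + t * B d d) := by linarith
  have hslope : 0 ≤ 2 * B w d + t * B d d := nonneg_of_mul_nonneg_right hfac ht0
  have habs : t * B d d ≤ t * |B d d| := mul_le_mul_of_nonneg_left (le_abs_self _) ht0.le
  have hcross : t * B w d < 0 := mul_neg_of_pos_of_neg ht0 hneg
  linarith

/-- 2nd generalized form of Farkas' Lemma (Theorem 3.6). -/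
theorem stmt_3 {X Y : Type*} [AddCommGroup X] [Module ℝ X] [AddCommGroup Y] [Module ℝ Y]
    (BX : X →ₗ[ℝ] X →ₗ[ℝ] ℝ) (hBXsymm : ∀ u v : X, BX u v = BX v u)
    (BY : Y →ₗ[ℝ] Y →ₗ[ℝ] ℝ) (hBYsymm : ∀ u v : Y, BY u v = BY v u)
    (T : Set Y) (hT0 : (0 : Y) ∈ T)
    (hTadd : ∀ y ∈ T, ∀ y' ∈ T, y + y' ∈ T)
    (hTsmul : ∀ r : ℝ, 0 ≤ r → ∀ y ∈ T, r • y ∈ T)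
    (A : X →ₗ[ℝ] Y) (At : Y →ₗ[ℝ] X)
    (hadj : ∀ (x : X) (y : Y), BY y (A x) = BX (At y) x)
    (c : X)
    (hpd : ∀ w ∈ (fun y => At y - c) '' T, w ≠ 0 → 0 < BX w w)
    (hmin : ∃ w₀ ∈ (fun y => At y - c) '' T, ∀ w ∈ (fun y => At y - c) '' T, BX w₀ w₀ ≤ BX w w) :
    Xor' (∃ y ∈ T, At y = c)
      (∃ x : X, (∀ y ∈ T, 0 ≤ BY (A x) y) ∧ BX x c < 0) := by
  obtain ⟨_, ⟨y₀, hy₀, rfl⟩, hle⟩ := hmin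
  simp only [Set.forall_mem_image] at hle hpd
  refine xor_iff_iff_not.mpr ?_
  constructor
  · rintro ⟨y, hy, rfl⟩ ⟨x, hx, hneg⟩
    rw [hBXsymm, ← hadj, hBYsymm] at hneg
    exact (hx y hy).not_gt hneg
  · intro hno
    by_contra hsol
    have hw : At y₀ - c ≠ 0 := fun h => hsol ⟨y₀, hy₀, sub_eq_zero.mp h⟩
    refine hno ⟨At y₀ - c, fun y hy => ?_, ?_⟩
    · rw [hBYsymm, hadj, hBXsymm]
      refine BX.nonneg_of_forall_le_add_smul hBXsymm fun t ht _ => ?_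
      have hmem := hle (hTadd _ hy₀ _ (hTsmul t ht y hy))
      rwa [map_add, map_smul, add_sub_right_comm] at hmem
    · have hshrink : 0 ≤ BX (At y₀ - c) (-At y₀) := by
        refine BX.nonneg_of_forall_le_add_smul hBXsymm fun t _ ht => ?_
        have hmem := hle (hTsmul (1 - t) (sub_nonneg.mpr ht) y₀ hy₀)
        have heq : At ((1 - t) • y₀) - c = At y₀ - c + t • -At y₀ := by
          rw [map_smul]; module
        rwa [heq] at hmem
      have hpos := hpd hy₀ hw
      rw [map_neg] at hshrink
      rw [map_sub (BX (At y₀ - c))] at hpos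
      linarith
end
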